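/- Row sums of the single-level transition operators: let ψ be infinitely differentiable on a neighborhood of [−1,1] and let n ≥ 1. Then for every μ ∈ 𝕁_n, the sum ∑_{λ ∈ 𝕁_n} T^ψ_n(μ,λ) converges absolutely and equals ψ(1)^{r_n}. -/

import Mathlib

open MeasureTheory Real

/-- Chebyshev polynomials of the second (`α = 1/2`) and third (`α = -1/2`) kind. -/
noncomputable def chebJ (α : ℝ) : ℕ → ℝ → ℝ
  | 0, _ => 1
  | 1, x => if α = 1 / 2 then 2 * x else 2 * x - 1
  | n + 2, x => 2 * x * chebJ α (n + 1) x - chebJ α n x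

/-- The normalized inner product `⟨f,g⟩_α`. -/
noncomputable def innerJ (α : ℝ) (f g : ℝ → ℝ) : ℝ :=
  (2 : ℝ) ^ (α + 1 / 2) / Real.pi *
    ∫ x in (-1 : ℝ)..1, f x * g x * (1 - x) ^ α * (1 + x) ^ ((1 : ℝ) / 2)

/-- `r_n = ⌊(n+1)/2⌋`. -/
def rr (n : ℕ) : ℕ := (n + 1) / 2

/-- `α_n = 1/2` if `n` even, `-1/2` if `n` odd. -/
noncomputable def alph (n : ℕ) : ℝ := if Even n then 1 / 2 else -(1 / 2)

/-- `dim_n λ`. -/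
noncomputable def dimSp (n : ℕ) (lam : Fin (rr n) → ℕ) : ℝ :=
  let r : ℕ := rr n
  let L : Fin r → ℝ := fun i => (lam i : ℝ) + (r : ℝ) - (i : ℕ)
  let M : Fin r → ℝ := fun i => (r : ℝ) - (i : ℕ)
  if Even n then
    (∏ i : Fin r, ∏ j ∈ Finset.Ioi i, ((L i) ^ 2 - (L j) ^ 2) / ((M i) ^ 2 - (M j) ^ 2)) *
      ∏ i : Fin r, L i / M i
  else
    ∏ i : Fin r, ∏ j ∈ Finset.Ioi i,
      ((L i - 1 / 2) ^ 2 - (L j - 1 / 2) ^ 2) / ((M i - 1 / 2) ^ 2 - (M j - 1 / 2) ^ 2)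

/-- The single-level transition operator
`T^ψ_n(μ,λ) := det[⟨J_{μ̃_i,α_n}, J_{λ̃_j,α_n}·ψ⟩_{α_n}]·(dim_n λ / dim_n μ)`. -/
noncomputable def Tpsi (ψ : ℝ → ℝ) (n : ℕ) (μ lam : Fin (rr n) → ℕ) : ℝ :=
  Matrix.det (Matrix.of fun i j : Fin (rr n) =>
    innerJ (alph n) (chebJ (alph n) (μ i + (rr n - 1 - (i : ℕ))))
      (fun x => chebJ (alph n) (lam j + (rr n - 1 - (j : ℕ))) x * ψ x)) *
  (dimSp n lam / dimSp n μ)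

/-- The `m`-th cosine coefficient of `f` on `[0, π]`. -/
noncomputable def cosCoeff (f : ℝ → ℝ) (m : ℤ) : ℝ :=
  1 / π * ∫ θ in (0 : ℝ)..π, cos (m * θ) * f θ

lemma cosCoeff_neg (f : ℝ → ℝ) (m : ℤ) : cosCoeff f (-m) = cosCoeff f m := by
  simp [cosCoeff]

/-- Integration by parts on a full period. -/
lemma integral_exp_mul_deriv {f : ℝ → ℂ} (hf : ContDiff ℝ (⊤ : ℕ∞) f)
    (hp : Function.Periodic f (2 * π)) (m : ℤ) :
    ∫ θ in (-π)..π, Complex.exp (-(m * θ * Complex.I)) * deriv f θ =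
      m * Complex.I * ∫ θ in (-π)..π, Complex.exp (-(m * θ * Complex.I)) * f θ := by
  have hexp : ∀ x : ℝ, HasDerivAt (fun θ : ℝ => Complex.exp (-(m * θ * Complex.I)))
      (Complex.exp (-(m * x * Complex.I)) * (-(m * Complex.I))) x := by
    intro x
    have h : HasDerivAt (fun θ : ℝ => (-(m * θ * Complex.I) : ℂ)) (-(m * Complex.I)) x := by
      simpa using! (((Complex.ofRealCLM.hasDerivAt (x := x)).const_mul (m : ℂ)).mul_const
        Complex.I).neg
    exact h.cexp
  have hd : ∀ x : ℝ, HasDerivAt f (deriv f x) x := fun x =>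
    (hf.differentiable (by simp) x).hasDerivAt
  have hcd : Continuous (deriv f) := hf.continuous_deriv (by simp)
  rw [intervalIntegral.integral_mul_deriv_eq_deriv_mul (fun x _ => hexp x) (fun x _ => hd x)
    (Continuous.intervalIntegrable (by fun_prop) _ _) (hcd.intervalIntegrable _ _)]
  have hb : f (-π) = f π := by
    have := hp (-π)
    rw [← this]; congr 1; ring
  have he : Complex.exp (-(m * (π : ℝ) * Complex.I)) =
      Complex.exp (-(m * ((-π : ℝ) : ℂ) * Complex.I)) := by
    rw [Complex.exp_eq_exp_iff_exists_int]
    refine ⟨-m, ?_⟩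
    push_cast; ring
  rw [hb, he, sub_self, zero_sub, ← intervalIntegral.integral_neg,
    ← intervalIntegral.integral_const_mul]
  congr 1; ext x; ring

/-- The Fourier coefficients of a smooth periodic function decay faster than any power. -/
lemma exists_bound_integral_exp (N : ℕ) : ∀ {f : ℝ → ℂ}, ContDiff ℝ (⊤ : ℕ∞) f →
    Function.Periodic f (2 * π) → ∃ C : ℝ, ∀ m : ℤ,
      |(m : ℝ)| ^ N * ‖∫ θ in (-π)..π, Complex.exp (-(m * θ * Complex.I)) * f θ‖ ≤ C := by
  induction N with
  | zero =>
    intro f hf hp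
    refine ⟨∫ θ in (-π)..π, ‖f θ‖, fun m => ?_⟩
    rw [pow_zero, one_mul]
    refine (intervalIntegral.norm_integral_le_integral_norm (by linarith [pi_pos])).trans
      (le_of_eq ?_)
    congr 1; ext θ
    rw [norm_mul, Complex.norm_exp]
    simp
  | succ N ih =>
    intro f hf hp
    have hf' : ContDiff ℝ (⊤ : ℕ∞) (deriv f) := by
      have := (contDiff_infty_iff_deriv (f := f)).1 hf
      exact this.2
    have hp' : Function.Periodic (deriv f) (2 * π) := by
      intro x
      rw [← deriv_comp_add_const]
      congr 1
      exact funext hp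
    obtain ⟨C, hC⟩ := ih hf' hp'
    refine ⟨C, fun m => ?_⟩
    have := hC m
    rw [integral_exp_mul_deriv hf hp, norm_mul, norm_mul, Complex.norm_I, mul_one,
      Complex.norm_intCast] at this
    rw [pow_succ, mul_assoc]
    exact this

/-- For an even function, the Fourier coefficients are the cosine coefficients. -/
lemma integral_exp_eq_cosCoeff {f : ℝ → ℝ} (hf : Continuous f) (he : ∀ x, f (-x) = f x) (m : ℤ) :
    ∫ θ in (-π)..π, Complex.exp (-(m * θ * Complex.I)) * (f θ : ℂ) =
      2 * π * (cosCoeff f m : ℂ) := by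
  have hi : ∀ a b : ℝ, IntervalIntegrable
      (fun θ : ℝ => Complex.exp (-(m * θ * Complex.I)) * (f θ : ℂ)) volume a b := fun a b =>
    Continuous.intervalIntegrable (by fun_prop) _ _
  rw [← intervalIntegral.integral_add_adjacent_intervals (hi (-π) 0) (hi 0 π)]
  have h1 := intervalIntegral.integral_comp_neg (a := 0) (b := π)
    (fun θ : ℝ => Complex.exp (-(m * θ * Complex.I)) * (f θ : ℂ))
  rw [neg_zero] at h1
  rw [← h1, ← intervalIntegral.integral_add _ (hi 0 π)]
  · have h2 : ∀ θ : ℝ, Complex.exp (-(m * ((-θ : ℝ) : ℂ) * Complex.I)) * ((f (-θ) : ℝ) : ℂ) +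
        Complex.exp (-(m * θ * Complex.I)) * (f θ : ℂ) = ((2 * (cos (m * θ) * f θ) : ℝ) : ℂ) := by
      intro θ
      rw [he]
      push_cast
      rw [Complex.cos]
      ring_nf
    simp_rw [h2]
    rw [intervalIntegral.integral_ofReal, intervalIntegral.integral_const_mul, cosCoeff]
    have := pi_ne_zero
    push_cast
    field_simp
  · exact Continuous.intervalIntegrable (by fun_prop) _ _

lemma summable_cosCoeff_mul_pow {f : ℝ → ℝ} (hf : ContDiff ℝ (⊤ : ℕ∞) f)
    (hp : Function.Periodic f (2 * π)) (he : ∀ x, f (-x) = f x) (N : ℕ) :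
    Summable fun m : ℤ => cosCoeff f m * (m : ℝ) ^ N := by
  have hfc : ContDiff ℝ (⊤ : ℕ∞) (fun x => (f x : ℂ)) := Complex.ofRealCLM.contDiff.comp hf
  have hpc : Function.Periodic (fun x => (f x : ℂ)) (2 * π) := fun x => by simp [hp x]
  have key : ∀ M : ℕ, ∃ C : ℝ, ∀ m : ℤ, |(m : ℝ)| ^ M * |cosCoeff f m| ≤ C := by
    intro M
    obtain ⟨C, hC⟩ := exists_bound_integral_exp M hfc hpc
    refine ⟨C / (2 * π), fun m => ?_⟩
    have := hC m
    rw [integral_exp_eq_cosCoeff hf.continuous he, norm_mul] at this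
    have h2 : ‖(2 * π : ℂ)‖ = 2 * π := by
      simp [abs_of_pos pi_pos]
    rw [h2, Complex.norm_real, Real.norm_eq_abs] at this
    rw [le_div_iff₀ (by positivity)]
    linarith
  obtain ⟨C, hC⟩ := key (N + 2)
  have hs : Summable fun m : ℤ => C * (1 / (m : ℝ) ^ 2) :=
    (Real.summable_one_div_int_pow.2 (by norm_num)).mul_left C
  refine Summable.of_norm_bounded_eventually hs ?_
  have : ∀ᶠ m : ℤ in Filter.cofinite, m ≠ 0 := by
    exact (Set.finite_singleton (0 : ℤ)).compl_mem_cofinite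
  filter_upwards [this] with m hm
  have h0 : (0 : ℝ) < (m : ℝ) ^ 2 := by positivity
  rw [mul_one_div, le_div_iff₀ h0, Real.norm_eq_abs, abs_mul, abs_pow]
  refine le_trans (le_of_eq ?_) (hC m)
  rw [← sq_abs]; ring

lemma hasSum_cosCoeff {f : ℝ → ℝ} (hf : ContDiff ℝ (⊤ : ℕ∞) f)
    (hp : Function.Periodic f (2 * π)) (he : ∀ x, f (-x) = f x) :
    HasSum (cosCoeff f) (f 0) := by
  have : Fact (0 < 2 * π) := ⟨by positivity⟩
  have hpc : Function.Periodic (fun x => (f x : ℂ)) (2 * π) := fun x => by simp [hp x]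
  let F : C(AddCircle (2 * π), ℂ) :=
    ⟨hpc.lift, continuous_coinduced_dom.2 (Complex.continuous_ofReal.comp hf.continuous)⟩
  have hF : ∀ x : ℝ, F (x : AddCircle (2 * π)) = f x := fun x => hpc.lift_coe x
  have hc : ∀ m : ℤ, fourierCoeff F m = (cosCoeff f m : ℂ) := by
    intro m
    rw [fourierCoeff_eq_intervalIntegral _ _ (-π)]
    have h1 : ∀ x : ℝ, fourier (-m) (x : AddCircle (2 * π)) • F (x : AddCircle (2 * π)) =
        Complex.exp (-(m * x * Complex.I)) * (f x : ℂ) := by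
      intro x
      rw [hF, fourier_coe_apply, smul_eq_mul]
      congr 2
      have : (π : ℂ) ≠ 0 := by exact_mod_cast pi_ne_zero
      push_cast
      field_simp
    simp_rw [h1]
    rw [show -π + 2 * π = π by ring, integral_exp_eq_cosCoeff hf.continuous he]
    have : (π : ℂ) ≠ 0 := by exact_mod_cast pi_ne_zero
    rw [Complex.real_smul]
    push_cast
    field_simp
  have hs : Summable (fourierCoeff F) := by
    have := summable_cosCoeff_mul_pow hf hp he 0
    simp only [pow_zero, mul_one] at this
    have h3 := Complex.ofRealCLM.summable this
    refine h3.congr fun m => (hc m).symm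
  have := has_pointwise_sum_fourier_series_of_summable hs ((0 : ℝ) : AddCircle (2 * π))
  rw [hF] at this
  refine Complex.hasSum_ofReal.1 ?_
  convert! this using 2 with m
  rw [hc]
  simp

lemma chebJ_half_mul_sin (θ : ℝ) : ∀ k : ℕ,
    chebJ (1 / 2) k (cos θ) * sin θ = sin ((k + 1) * θ)
  | 0 => by simp [chebJ]
  | 1 => by
    simp only [chebJ, if_true]
    rw [show ((1 : ℕ) + 1 : ℝ) * θ = 2 * θ by push_cast; ring, sin_two_mul]; ring
  | k + 2 => by
    have h1 := chebJ_half_mul_sin θ (k + 1)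
    have h0 := chebJ_half_mul_sin θ k
    rw [chebJ, sub_mul, mul_assoc, h1, h0]
    push_cast
    rw [show ((k : ℝ) + 2 + 1) * θ = (k + 1 + 1) * θ + θ by ring,
      show ((k : ℝ) + 1) * θ = (k + 1 + 1) * θ - θ by ring, sin_add, sin_sub]
    ring

lemma chebJ_neg_half_mul_cos (θ : ℝ) : ∀ k : ℕ,
    chebJ (-(1 / 2)) k (cos θ) * cos (θ / 2) = cos ((k + 1 / 2) * θ)
  | 0 => by simp only [chebJ]; push_cast; ring_nf
  | 1 => by
    have h : ¬ ((-(1 / 2) : ℝ) = 1 / 2) := by norm_num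
    simp only [chebJ, if_neg h]
    have e1 : θ = 2 * (θ / 2) := by ring
    rw [show (((1 : ℕ) : ℝ) + 1 / 2) * θ = 3 * (θ / 2) by push_cast; ring, cos_three_mul]
    nth_rewrite 1 [e1]
    rw [cos_two_mul]; ring
  | k + 2 => by
    have h1 := chebJ_neg_half_mul_cos θ (k + 1)
    have h0 := chebJ_neg_half_mul_cos θ k
    rw [chebJ, sub_mul, mul_assoc, h1, h0]
    push_cast
    rw [show ((k : ℝ) + 2 + 1 / 2) * θ = (k + 1 + 1 / 2) * θ + θ by ring,
      show ((k : ℝ) + 1 / 2) * θ = (k + 1 + 1 / 2) * θ - θ by ring, cos_add, cos_sub]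
    ring

lemma integral_mul_sqrt_inv (f : ℝ → ℝ) :
    ∫ x in (-1 : ℝ)..1, f x * √(1 - x ^ 2)⁻¹ = ∫ θ in (0 : ℝ)..π, f (cos θ) := by
  rw [← Polynomial.Chebyshev.integral_measureT,
    Polynomial.Chebyshev.integral_measureT_eq_integral_cos]

lemma innerJ_half {ψ : ℝ → ℝ} (hψ : Continuous fun θ => ψ (cos θ)) (p k : ℕ) :
    innerJ (1 / 2) (chebJ (1 / 2) p) (fun x => chebJ (1 / 2) k x * ψ x) =
      cosCoeff (fun θ => ψ (cos θ)) (p - k) - cosCoeff (fun θ => ψ (cos θ)) (p + k + 2) := by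
  have h1 : ∫ x in (-1 : ℝ)..1, chebJ (1 / 2) p x * (chebJ (1 / 2) k x * ψ x) *
        (1 - x) ^ (1 / 2 : ℝ) * (1 + x) ^ (1 / 2 : ℝ) =
      ∫ x in (-1 : ℝ)..1, (chebJ (1 / 2) p x * (chebJ (1 / 2) k x * ψ x) * (1 - x ^ 2)) *
        √(1 - x ^ 2)⁻¹ := by
    refine intervalIntegral.integral_congr_Ioo_of_le (by norm_num) fun x hx => ?_
    have ha : 0 < 1 - x := by linarith [hx.2]
    have hb : 0 < 1 + x := by linarith [hx.1]
    have hab : 1 - x ^ 2 = (1 - x) * (1 + x) := by ring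
    have hs : 1 - x ^ 2 = √(1 - x ^ 2) * √(1 - x ^ 2) := by
      rw [Real.mul_self_sqrt]; rw [hab]; positivity
    have hn : √(1 - x ^ 2) ≠ 0 := by
      rw [hab]; positivity
    rw [← Real.sqrt_eq_rpow, ← Real.sqrt_eq_rpow, mul_assoc, ← Real.sqrt_mul ha.le, ← hab,
      Real.sqrt_inv, mul_assoc (_ * _) (1 - x ^ 2)]
    congr 1
    nth_rewrite 2 [hs]
    field_simp
  have hi : ∀ m : ℤ,
      IntervalIntegrable (fun θ : ℝ => cos (m * θ) * ψ (cos θ)) volume 0 π := fun m =>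
    ((by fun_prop : Continuous fun θ : ℝ => cos (m * θ)).mul hψ).intervalIntegrable _ _
  rw [innerJ, h1, integral_mul_sqrt_inv, cosCoeff, cosCoeff, ← mul_sub,
    ← intervalIntegral.integral_sub (hi _) (hi _),
    show (1 / 2 + 1 / 2 : ℝ) = 1 by norm_num, rpow_one, div_mul_eq_mul_div, div_mul_eq_mul_div,
    one_mul, ← intervalIntegral.integral_const_mul]
  congr 2; ext θ
  have e1 := chebJ_half_mul_sin θ p
  have e2 := chebJ_half_mul_sin θ k
  rw [← sin_sq, show (2 : ℝ) * (chebJ (1 / 2) p (cos θ) * (chebJ (1 / 2) k (cos θ) * ψ (cos θ)) *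
    sin θ ^ 2) = 2 * (chebJ (1 / 2) p (cos θ) * sin θ) * (chebJ (1 / 2) k (cos θ) * sin θ) *
      ψ (cos θ) by ring, e1, e2]
  push_cast
  rw [show ((p : ℝ) - k) * θ = (p + 1) * θ - (k + 1) * θ by ring,
    show ((p : ℝ) + k + 2) * θ = (p + 1) * θ + (k + 1) * θ by ring, cos_sub, cos_add]
  ring

lemma innerJ_neg_half {ψ : ℝ → ℝ} (hψ : Continuous fun θ => ψ (cos θ)) (p k : ℕ) :
    innerJ (-(1 / 2)) (chebJ (-(1 / 2)) p) (fun x => chebJ (-(1 / 2)) k x * ψ x) =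
      cosCoeff (fun θ => ψ (cos θ)) (p - k) + cosCoeff (fun θ => ψ (cos θ)) (p + k + 1) := by
  have h1 : ∫ x in (-1 : ℝ)..1, chebJ (-(1 / 2)) p x * (chebJ (-(1 / 2)) k x * ψ x) *
        (1 - x) ^ (-(1 / 2) : ℝ) * (1 + x) ^ (1 / 2 : ℝ) =
      ∫ x in (-1 : ℝ)..1, (chebJ (-(1 / 2)) p x * (chebJ (-(1 / 2)) k x * ψ x) * (1 + x)) *
        √(1 - x ^ 2)⁻¹ := by
    refine intervalIntegral.integral_congr_Ioo_of_le (by norm_num) fun x hx => ?_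
    have ha : 0 < 1 - x := by linarith [hx.2]
    have hb : 0 < 1 + x := by linarith [hx.1]
    have hab : 1 - x ^ 2 = (1 - x) * (1 + x) := by ring
    have hs : 1 + x = √(1 + x) * √(1 + x) := by
      rw [Real.mul_self_sqrt hb.le]
    have hn : √(1 + x) ≠ 0 := by positivity
    have hn' : √(1 - x) ≠ 0 := by positivity
    rw [Real.rpow_neg ha.le, ← Real.sqrt_eq_rpow, ← Real.sqrt_eq_rpow, mul_assoc, hab,
      Real.sqrt_inv, mul_assoc (_ * _) (1 + x), Real.sqrt_mul ha.le]
    congr 1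
    nth_rewrite 2 [hs]
    field_simp
  have hi : ∀ m : ℤ,
      IntervalIntegrable (fun θ : ℝ => cos (m * θ) * ψ (cos θ)) volume 0 π := fun m =>
    ((by fun_prop : Continuous fun θ : ℝ => cos (m * θ)).mul hψ).intervalIntegrable _ _
  rw [innerJ, h1, integral_mul_sqrt_inv, cosCoeff, cosCoeff, ← mul_add,
    ← intervalIntegral.integral_add (hi _) (hi _),
    show (-(1 / 2) + 1 / 2 : ℝ) = 0 by norm_num, rpow_zero]
  congr 2; ext θ
  have e1 := chebJ_neg_half_mul_cos θ p
  have e2 := chebJ_neg_half_mul_cos θ k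
  have e3 : 1 + cos θ = 2 * cos (θ / 2) ^ 2 := by
    rw [show cos θ = cos (2 * (θ / 2)) by ring_nf, cos_two_mul]; ring
  rw [e3, show chebJ (-(1 / 2)) p (cos θ) * (chebJ (-(1 / 2)) k (cos θ) * ψ (cos θ)) *
    (2 * cos (θ / 2) ^ 2) = 2 * (chebJ (-(1 / 2)) p (cos θ) * cos (θ / 2)) *
      (chebJ (-(1 / 2)) k (cos θ) * cos (θ / 2)) * ψ (cos θ) by ring, e1, e2]
  push_cast
  rw [show ((p : ℝ) - k) * θ = (p + 1 / 2) * θ - (k + 1 / 2) * θ by ring,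
    show ((p : ℝ) + k + 1) * θ = (p + 1 / 2) * θ + (k + 1 / 2) * θ by ring, cos_sub, cos_add]
  ring

lemma HasSum.mul_of_real {ι κ : Type*} {f : ι → ℝ} {g : κ → ℝ} {a b : ℝ} (hf : HasSum f a)
    (hg : HasSum g b) : HasSum (fun x : ι × κ => f x.1 * g x.2) (a * b) :=
  hf.mul hg (summable_mul_of_summable_norm hf.summable.norm hg.summable.norm)

lemma hasSum_prod_pi {r : ℕ} {F : Fin r → ℕ → ℝ} {S : Fin r → ℝ} (h : ∀ i, HasSum (F i) (S i)) :
    HasSum (fun f : Fin r → ℕ => ∏ i, F i (f i)) (∏ i, S i) := by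
  induction r with
  | zero => simp
  | succ r ih =>
    rw [Fin.prod_univ_succ, ← (Fin.consEquiv fun _ : Fin (r + 1) => ℕ).hasSum_iff]
    have := (h 0).mul_of_real (ih fun i : Fin r => h i.succ)
    convert! this using 2 with x
    simp [Fin.consEquiv, Fin.prod_univ_succ]

/-- The strictly decreasing sequence obtained from a partition by adding the staircase. -/
def stairShift {r : ℕ} (l : Fin r → ℕ) (j : Fin r) : ℕ := l j + (r - 1 - (j : ℕ))

lemma stairShift_strictAnti {r : ℕ} {l : Fin r → ℕ} (hl : Antitone l) :
    StrictAnti (stairShift l) := by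
  intro i j hij
  have := hl hij.le
  have h1 : (i : ℕ) < j := hij
  have := j.isLt
  simp only [stairShift]
  omega

lemma stairShift_injective {r : ℕ} : Function.Injective (stairShift (r := r)) := by
  intro l l' h
  ext j
  have := congrFun h j
  simp only [stairShift] at this
  omega

lemma exists_stairShift_eq {r : ℕ} {g : Fin r → ℕ} (hg : StrictAnti g) :
    ∃ l : Fin r → ℕ, Antitone l ∧ stairShift l = g := by
  have step : ∀ i j : Fin r, i ≤ j → g j + (j - i : ℕ) ≤ g i := by
    intro i
    suffices ∀ d : ℕ, ∀ j : Fin r, (j : ℕ) = i + d → g j + d ≤ g i by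
      intro j hij
      have hij' : (i : ℕ) ≤ j := hij
      exact this _ j (by omega)
    intro d
    induction d with
    | zero => intro j hj; rw [show j = i from Fin.ext hj]; simp
    | succ d ih =>
      intro j hj
      have h1 := ih ⟨i + d, by omega⟩ rfl
      have h2 : g j < g ⟨i + d, by omega⟩ := hg (by rw [Fin.lt_def]; simp only; omega)
      omega
  have low : ∀ j : Fin r, r - 1 - (j : ℕ) ≤ g j := by
    intro j
    have := j.isLt
    have := step j ⟨r - 1, by omega⟩ (by rw [Fin.le_def]; simp only; omega)
    simp only at this
    omega
  refine ⟨fun j => g j - (r - 1 - (j : ℕ)), fun i j hij => ?_, ?_⟩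
  · have h1 := step i j hij
    have h2 := low i
    have h3 := low j
    have h4 : (i : ℕ) ≤ j := hij
    have := j.isLt
    simp only
    omega
  · ext j
    have := low j
    simp only [stairShift]
    omega

lemma strictAnti_comp_perm_injective {r : ℕ} {g g' : Fin r → ℕ} (hg : StrictAnti g)
    (hg' : StrictAnti g') {σ τ : Equiv.Perm (Fin r)} (h : g ∘ σ = g' ∘ τ) : g = g' ∧ σ = τ := by
  have hr : Set.range g = Set.range g' := by
    rw [← σ.surjective.range_comp g, h, τ.surjective.range_comp]
  have h1 : g ∘ Fin.rev = g' ∘ Fin.rev := by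
    refine (StrictMono.range_inj (f := g ∘ Fin.rev) (g := g' ∘ Fin.rev)
      (hg.comp Fin.rev_strictAnti) (hg'.comp Fin.rev_strictAnti)).1 ?_
    rw [Fin.rev_surjective.range_comp, Fin.rev_surjective.range_comp, hr]
  have h2 : g = g' := by
    ext j
    simpa using congrFun h1 j.rev
  subst h2
  refine ⟨rfl, Equiv.ext fun j => hg.injective (congrFun h j)⟩

lemma exists_strictAnti_comp_perm {r : ℕ} {f : Fin r → ℕ} (hf : Function.Injective f) :
    ∃ g : Fin r → ℕ, ∃ σ : Equiv.Perm (Fin r), StrictAnti g ∧ g ∘ σ = f := by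
  have hm : StrictMono (f ∘ Tuple.sort f) :=
    (Tuple.monotone_sort f).strictMono_of_injective (hf.comp (Tuple.sort f).injective)
  refine ⟨f ∘ Tuple.sort f ∘ Fin.rev, (Tuple.sort f).symm.trans Fin.revPerm,
    hm.comp_strictAnti Fin.rev_strictAnti, ?_⟩
  ext j
  simp

/-- The Cauchy–Binet formula for infinitely many columns, which are indexed by partitions. -/
lemma hasSum_det_mul_det {r : ℕ} {A B : Fin r → ℕ → ℝ} {C : Matrix (Fin r) (Fin r) ℝ}
    (h : ∀ i j, HasSum (fun k => A i k * B j k) (C i j)) :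
    HasSum (fun l : {l : Fin r → ℕ // Antitone l} =>
      (Matrix.of fun i j => A i (stairShift l.1 j)).det *
        (Matrix.of fun i j => B j (stairShift l.1 i)).det) C.det := by
  let H : (Fin r → ℕ) → ℝ := fun f =>
    (Matrix.of fun i j => A i (f j)).det * ∏ j, B j (f j)
  have hH : HasSum H C.det := by
    have h1 : H = fun f => ∑ σ : Equiv.Perm (Fin r),
        ((Equiv.Perm.sign σ : ℤ) : ℝ) * ∏ j, A (σ j) (f j) * B j (f j) := by
      ext f
      simp only [H, Matrix.det_apply', Finset.sum_mul, Matrix.of_apply, Finset.prod_mul_distrib,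
        mul_assoc]
    rw [h1, Matrix.det_apply']
    exact hasSum_sum fun σ _ => (hasSum_prod_pi fun j => h (σ j) j).mul_left _
  let e : {l : Fin r → ℕ // Antitone l} × Equiv.Perm (Fin r) → (Fin r → ℕ) :=
    fun x => stairShift x.1.1 ∘ x.2
  have he : Function.Injective e := by
    rintro ⟨l, σ⟩ ⟨l', τ⟩ hx
    obtain ⟨h1, h2⟩ := strictAnti_comp_perm_injective (stairShift_strictAnti l.2)
      (stairShift_strictAnti l'.2) hx
    rw [Prod.mk.injEq]
    exact ⟨Subtype.ext (stairShift_injective h1), h2⟩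
  have hsupp : ∀ f, f ∉ Set.range e → H f = 0 := by
    intro f hf
    have hni : ¬ Function.Injective f := by
      intro hi
      obtain ⟨g, σ, hg, rfl⟩ := exists_strictAnti_comp_perm hi
      obtain ⟨l, hl, rfl⟩ := exists_stairShift_eq hg
      exact hf ⟨(⟨l, hl⟩, σ), rfl⟩
    simp only [Function.Injective, not_forall] at hni
    obtain ⟨i, j, hij, hne⟩ := hni
    have : (Matrix.of fun i j => A i (f j)).det = 0 :=
      Matrix.det_zero_of_column_eq hne fun k => by simp [hij]
    simp [H, this]
  refine ((he.hasSum_iff hsupp).2 hH).prod_fiberwise fun l => ?_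
  have h2 : ∀ σ : Equiv.Perm (Fin r), (H ∘ e) (l, σ) =
      (Matrix.of fun i j => A i (stairShift l.1 j)).det *
        (((Equiv.Perm.sign σ : ℤ) : ℝ) * ∏ j, B j (stairShift l.1 (σ j))) := by
    intro σ
    have h3 := Matrix.det_permute' σ (Matrix.of fun i j => A i (stairShift l.1 j))
    have h4 : (Matrix.of fun i j => A i (e (l, σ) j)) =
      (Matrix.of fun i j => A i (stairShift l.1 j)).submatrix id σ := rfl
    change (Matrix.of fun i j => A i (e (l, σ) j)).det * ∏ j, B j (stairShift l.1 (σ j)) = _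
    rw [h4, h3]
    ring
  simp_rw [h2]
  rw [Matrix.det_apply' (Matrix.of fun i j => B j (stairShift l.1 i)), Finset.mul_sum]
  exact hasSum_fintype _

lemma tsum_mul_odd_pow {a : ℤ → ℝ} (ha : ∀ m, a (-m) = a m) {N : ℕ} (hN : Odd N) :
    ∑' m : ℤ, a m * (m : ℝ) ^ N = 0 := by
  have h := (Equiv.neg ℤ).tsum_eq fun m : ℤ => a m * (m : ℝ) ^ N
  simp only [Equiv.neg_apply, ha, Int.cast_neg, hN.neg_pow, mul_neg, tsum_neg] at h
  linarith

lemma sum_range_two_mul_add_two (f : ℕ → ℝ) (m : ℕ) :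
    ∑ t ∈ Finset.range (2 * m + 2), f t =
      ∑ s ∈ Finset.range (m + 1), (f (2 * s) + f (2 * s + 1)) := by
  induction m with
  | zero => simp [Finset.sum_range_succ]
  | succ m ih =>
    rw [show 2 * (m + 1) + 2 = 2 * m + 2 + 1 + 1 by ring, Finset.sum_range_succ,
      Finset.sum_range_succ, ih, Finset.sum_range_succ _ (m + 1)]
    ring_nf

/-- The matrix of convolution with an even sequence, acting on powers of a fixed parity. -/
noncomputable def momentMatrix (a : ℤ → ℝ) (ε m s : ℕ) : ℝ :=
  (2 * m + ε).choose (2 * s + ε) * ∑' j : ℤ, a j * (j : ℝ) ^ (2 * m - 2 * s)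

lemma hasSum_mul_sub_pow {a : ℤ → ℝ} (ha : ∀ m, a (-m) = a m)
    (hs : ∀ N : ℕ, Summable fun m : ℤ => a m * (m : ℝ) ^ N) (x : ℝ) {ε : ℕ} (hε : ε ≤ 1) (m : ℕ) :
    HasSum (fun j : ℤ => a j * (x - j) ^ (2 * m + ε))
      (∑ s ∈ Finset.range (m + 1), momentMatrix a ε m s * x ^ (2 * s + ε)) := by
  set N := 2 * m + ε with hN
  let G : ℕ → ℝ := fun t => N.choose t * x ^ t * (-1) ^ (N - t) * ∑' j : ℤ, a j * (j : ℝ) ^ (N - t)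
  have h1 : HasSum (fun j : ℤ => a j * (x - j) ^ N) (∑ t ∈ Finset.range (N + 1), G t) := by
    have h2 := hasSum_sum (s := Finset.range (N + 1)) fun t _ =>
      ((hs (N - t)).hasSum.mul_left (N.choose t * x ^ t * (-1) ^ (N - t)))
    convert! h2 using 1
    ext j
    rw [sub_eq_add_neg, add_pow, Finset.mul_sum]
    refine Finset.sum_congr rfl fun t _ => ?_
    rw [neg_pow (j : ℝ)]
    ring
  have h3 : ∑ t ∈ Finset.range (N + 1), G t = ∑ t ∈ Finset.range (2 * m + 2), G t := by
    refine Finset.sum_subset (Finset.range_mono (by omega)) fun t _ ht => ?_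
    rw [Finset.mem_range, not_lt] at ht
    simp [G, Nat.choose_eq_zero_of_lt (show N < t by omega)]
  rw [h3, sum_range_two_mul_add_two] at h1
  convert! h1 using 1
  refine Finset.sum_congr rfl fun s hs' => ?_
  rw [Finset.mem_range] at hs'
  have hev : Even (2 * m - 2 * s) := ⟨m - s, by omega⟩
  interval_cases ε
  · have : G (2 * s + 1) = 0 := by
      by_cases h : s = m
      · simp [G, Nat.choose_eq_zero_of_lt (show N < 2 * s + 1 by omega)]
      · have ho : Odd (N - (2 * s + 1)) := ⟨m - s - 1, by omega⟩
        simp only [G, tsum_mul_odd_pow ha ho, mul_zero]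
    rw [this]
    simp only [G, momentMatrix, hN, add_zero, hev.neg_one_pow]
    ring
  · have : G (2 * s) = 0 := by
      have ho : Odd (N - 2 * s) := ⟨m - s, by omega⟩
      simp only [G, tsum_mul_odd_pow ha ho, mul_zero]
    rw [this]
    simp only [G, momentMatrix, hN, show 2 * m + 1 - (2 * s + 1) = 2 * m - 2 * s by omega,
      hev.neg_one_pow]
    ring

lemma hasSum_sub_mul_pow {a : ℤ → ℝ} (ha : ∀ m, a (-m) = a m)
    (hs : ∀ N : ℕ, Summable fun m : ℤ => a m * (m : ℝ) ^ N) (p m : ℕ) :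
    HasSum (fun k : ℕ => (a (p - k) - a (p + k + 2)) * ((k : ℝ) + 1) ^ (2 * m + 1))
      (∑ s ∈ Finset.range (m + 1), momentMatrix a 1 m s * ((p : ℝ) + 1) ^ (2 * s + 1)) := by
  have h := hasSum_mul_sub_pow ha hs ((p : ℝ) + 1) le_rfl m
  rw [← (Equiv.subLeft ((p : ℤ) + 1)).hasSum_iff] at h
  have h2 := (hasSum_nat_add_iff' 1).2 h.nat_add_neg
  convert! h2 using 1
  · ext k
    simp only [Function.comp, Equiv.subLeft_apply]
    push_cast
    rw [show (p : ℤ) + 1 - (k + 1) = p - k by ring, show (p : ℤ) + 1 - -(k + 1) = p + k + 2 by ring,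
      show (p : ℝ) + 1 - (p + 1 - (k + 1)) = k + 1 by ring,
      show (p : ℝ) + 1 - (p + 1 - -(k + 1)) = -(k + 1) by ring,
      (show Odd (2 * m + 1) from ⟨m, rfl⟩).neg_pow]
    ring
  · simp

lemma hasSum_add_mul_pow {a : ℤ → ℝ} (ha : ∀ m, a (-m) = a m)
    (hs : ∀ N : ℕ, Summable fun m : ℤ => a m * (m : ℝ) ^ N) (p m : ℕ) :
    HasSum (fun k : ℕ => (a (p - k) + a (p + k + 1)) * ((k : ℝ) + 1 / 2) ^ (2 * m + 0))
      (∑ s ∈ Finset.range (m + 1), momentMatrix a 0 m s * ((p : ℝ) + 1 / 2) ^ (2 * s + 0)) := by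
  have h := hasSum_mul_sub_pow ha hs ((p : ℝ) + 1 / 2) zero_le_one m
  rw [← (Equiv.subLeft (p : ℤ)).hasSum_iff] at h
  convert! h.nat_add_neg_add_one using 1
  ext k
  simp only [Function.comp, Equiv.subLeft_apply]
  push_cast
  rw [show (p : ℤ) - -(k + 1) = p + k + 1 by ring,
    show (p : ℝ) + 1 / 2 - (p - k) = k + 1 / 2 by ring,
    show (p : ℝ) + 1 / 2 - (p - -(k + 1)) = -(k + 1 / 2) by ring,
    (show Even (2 * m + 0) from ⟨m, by ring⟩).neg_pow]
  ring

/-- The Vandermonde-type determinant in the squares of `w`. -/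
noncomputable def parityVandermonde {r : ℕ} (ε : ℕ) (w : Fin r → ℝ) : ℝ :=
  (Matrix.of fun i j : Fin r => w i ^ (2 * (j : ℕ) + ε)).det

lemma parityVandermonde_eq {r : ℕ} (ε : ℕ) (w : Fin r → ℝ) :
    parityVandermonde ε w =
      (∏ i, ∏ j ∈ Finset.Ioi i, (w j ^ 2 - w i ^ 2)) * ∏ i, w i ^ ε := by
  rw [← Matrix.det_vandermonde, mul_comm, ← Matrix.det_mul_column, parityVandermonde]
  congr 1; ext i j
  simp only [Matrix.of_apply, Matrix.vandermonde_apply]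
  ring

lemma parityVandermonde_ne_zero {r : ℕ} (ε : ℕ) {w : Fin r → ℝ} (hw : ∀ i, 0 < w i)
    (hi : Function.Injective w) : parityVandermonde ε w ≠ 0 := by
  rw [parityVandermonde_eq]
  refine mul_ne_zero (Finset.prod_ne_zero_iff.2 fun i _ => Finset.prod_ne_zero_iff.2 fun j hj => ?_)
    (Finset.prod_ne_zero_iff.2 fun i _ => pow_ne_zero _ (hw i).ne')
  rw [sub_ne_zero]
  intro h
  have := hi ((pow_left_inj₀ (hw j).le (hw i).le two_ne_zero).1 h)
  exact (Finset.mem_Ioi.1 hj).ne' this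

lemma hasSum_det_mul_parityVandermonde {r ε : ℕ} {A U : ℕ → ℕ → ℝ} {v : ℕ → ℝ} {s : ℝ}
    (hA : ∀ p m, HasSum (fun k => A p k * v k ^ (2 * m + ε))
      (∑ t ∈ Finset.range (m + 1), U m t * v p ^ (2 * t + ε)))
    (hU : ∀ m, U m m = s) (q : Fin r → ℕ) :
    HasSum (fun l : {l : Fin r → ℕ // Antitone l} =>
      (Matrix.of fun i j => A (q i) (stairShift l.1 j)).det *
        parityVandermonde ε fun i => v (stairShift l.1 i))
      (s ^ r * parityVandermonde ε fun i => v (q i)) := by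
  let W : Matrix (Fin r) (Fin r) ℝ := Matrix.of fun j t => if t ≤ j then U j t else 0
  have hW : W.det = s ^ r := by
    rw [Matrix.det_of_isLowerTriangular W]
    · simp [W, hU]
    · intro i j hij
      have : i < j := hij
      simp [W, this]
  rw [← hW, ← Matrix.det_transpose W, mul_comm, parityVandermonde, ← Matrix.det_mul]
  refine hasSum_det_mul_det (A := fun i => A (q i)) (B := fun j k => v k ^ (2 * (j : ℕ) + ε))
    fun i j => ?_
  convert! hA (q i) j using 1
  simp only [Matrix.mul_apply, Matrix.transpose_apply, Matrix.of_apply, W]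
  have : ∀ t : Fin r, v (q i) ^ (2 * (t : ℕ) + ε) * (if t ≤ j then U j t else 0) =
      (fun t : ℕ => if t ≤ j then U j t * v (q i) ^ (2 * t + ε) else 0) t := by
    intro t
    simp only [Fin.le_def]
    split_ifs <;> ring
  simp_rw [this]
  rw [Fin.sum_univ_eq_sum_range
    (fun t : ℕ => if t ≤ j then U j t * v (q i) ^ (2 * t + ε) else 0) r, ← Finset.sum_filter]
  congr 1
  ext t
  have := j.isLt
  simp only [Finset.mem_filter, Finset.mem_range]
  omega

lemma cast_stairShift {r : ℕ} (l : Fin r → ℕ) (i : Fin r) :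
    (stairShift l i : ℝ) + 1 = (l i : ℝ) + r - (i : ℕ) := by
  have : stairShift l i + 1 + (i : ℕ) = l i + r := by
    have := i.isLt
    simp only [stairShift]
    omega
  have h : ((stairShift l i + 1 + (i : ℕ) : ℕ) : ℝ) = ((l i + r : ℕ) : ℝ) := by rw [this]
  push_cast at h
  linarith

lemma dimSp_even {n : ℕ} (hn : Even n) (l : Fin (rr n) → ℕ) :
    dimSp n l = parityVandermonde 1 (fun i => (stairShift l i : ℝ) + 1) /
      parityVandermonde 1 (fun i : Fin (rr n) => (stairShift 0 i : ℝ) + 1) := by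
  simp only [dimSp, if_pos hn, parityVandermonde_eq, cast_stairShift, pow_one, mul_div_mul_comm,
    ← Finset.prod_div_distrib]
  congr 1
  swap
  · simp
  refine Finset.prod_congr rfl fun i _ => Finset.prod_congr rfl fun j _ => ?_
  rw [← neg_div_neg_eq, neg_sub, neg_sub]
  simp

lemma dimSp_odd {n : ℕ} (hn : ¬ Even n) (l : Fin (rr n) → ℕ) :
    dimSp n l = parityVandermonde 0 (fun i => (stairShift l i : ℝ) + 1 / 2) /
      parityVandermonde 0 (fun i : Fin (rr n) => (stairShift 0 i : ℝ) + 1 / 2) := by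
  have h : ∀ (l : Fin (rr n) → ℕ) i, (stairShift l i : ℝ) + 1 / 2 =
      (l i : ℝ) + rr n - (i : ℕ) - 1 / 2 := fun l i => by rw [← cast_stairShift]; ring
  simp only [dimSp, if_neg hn, parityVandermonde_eq, h, pow_zero, Finset.prod_const_one, mul_one,
    ← Finset.prod_div_distrib]
  refine Finset.prod_congr rfl fun i _ => Finset.prod_congr rfl fun j _ => ?_
  rw [← neg_div_neg_eq, neg_sub, neg_sub]
  simp

/-- A common form of the row sum identity for both parities. -/
lemma hasSum_det_mul_dim_ratio {r ε : ℕ} {A U : ℕ → ℕ → ℝ} {c s : ℝ} (hc : 0 < c)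
    (hA : ∀ p m, HasSum (fun k => A p k * ((k : ℝ) + c) ^ (2 * m + ε))
      (∑ t ∈ Finset.range (m + 1), U m t * ((p : ℝ) + c) ^ (2 * t + ε)))
    (hU : ∀ m, U m m = s) {d : (Fin r → ℕ) → ℝ}
    (hd : ∀ l, d l = parityVandermonde ε (fun i => (stairShift l i : ℝ) + c) /
      parityVandermonde ε (fun i : Fin r => (stairShift 0 i : ℝ) + c))
    {μ : Fin r → ℕ} (hμ : Antitone μ) :
    HasSum (fun l : {l : Fin r → ℕ // Antitone l} =>
      (Matrix.of fun i j => A (stairShift μ i) (stairShift l.1 j)).det * (d l.1 / d μ))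
      (s ^ r) := by
  have hne : ∀ {l : Fin r → ℕ}, Antitone l →
      parityVandermonde ε (fun i => (stairShift l i : ℝ) + c) ≠ 0 := fun hl =>
    parityVandermonde_ne_zero ε (fun i => by positivity) fun i j hij =>
      (stairShift_strictAnti hl).injective (by exact_mod_cast add_right_cancel hij)
  have h0 := hne (l := 0) antitone_const
  have h := (hasSum_det_mul_parityVandermonde (v := fun k => (k : ℝ) + c) hA hU
    (stairShift μ)).div_const (parityVandermonde ε fun i => (stairShift μ i : ℝ) + c)
  rw [mul_div_cancel_right₀ _ (hne hμ)] at h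
  convert! h using 2 with l
  rw [hd, hd, div_div_div_cancel_right₀ h0, mul_div_assoc]

/-- Row sums of the single-level transition operators:
`∑_{λ ∈ 𝕁_n} T^ψ_n(μ,λ) = ψ(1)^{r_n}`. -/
theorem transition_row_sum (ψ : ℝ → ℝ) (U : Set ℝ) (hU : IsOpen U)
    (hsub : Set.Icc (-1 : ℝ) 1 ⊆ U) (hψ : ContDiffOn ℝ (⊤ : ℕ∞) ψ U)
    (n : ℕ) (hn : 1 ≤ n) (μ : { l : Fin (rr n) → ℕ // Antitone l }) :
    HasSum (fun lam : { l : Fin (rr n) → ℕ // Antitone l } => Tpsi ψ n μ.1 lam.1)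
      (ψ 1 ^ rr n) := by
  have hf : ContDiff ℝ (⊤ : ℕ∞) fun θ => ψ (cos θ) :=
    hψ.comp_contDiff contDiff_cos fun θ => hsub ⟨neg_one_le_cos θ, cos_le_one θ⟩
  have hp : Function.Periodic (fun θ => ψ (cos θ)) (2 * π) := fun θ => by simp
  have he : ∀ θ, ψ (cos (-θ)) = ψ (cos θ) := fun θ => by rw [cos_neg]
  have ha := cosCoeff_neg fun θ => ψ (cos θ)
  have hs := summable_cosCoeff_mul_pow hf hp he
  have hM : ∀ ε m : ℕ, momentMatrix (cosCoeff fun θ => ψ (cos θ)) ε m m = ψ 1 := fun ε m => by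
    simp [momentMatrix, (hasSum_cosCoeff hf hp he).tsum_eq]
  by_cases hev : Even n
  · have hα : alph n = 1 / 2 := if_pos hev
    simp only [Tpsi, hα, innerJ_half hf.continuous]
    exact hasSum_det_mul_dim_ratio one_pos (hasSum_sub_mul_pow ha hs) (hM 1) (dimSp_even hev) μ.2
  · have hα : alph n = -(1 / 2) := if_neg hev
    simp only [Tpsi, hα, innerJ_neg_half hf.continuous]
    exact hasSum_det_mul_dim_ratio one_half_pos (hasSum_add_mul_pow ha hs) (hM 0)
      (dimSp_odd hev) μ.2
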